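/- Let T be a deterministic map from datasets to ℝ^m with ℓ₂-sensitivity Δ₂(T), and let 0 < ε, δ < 1. Then the randomized algorithm M(D) = T(D) + ξ, where ξ = (ξ₁,…,ξ_m) has i.i.d. Gaussian coordinates with mean 0 and standard deviation √(2 log(1.25/δ))·Δ₂(T)/ε, is (ε,δ)-differentially private. -/

import Mathlib

open MeasureTheory ProbabilityTheory

/-- Two datasets of `n` records are neighboring if they differ in exactly one record. -/
def Neighboring {X : Type*} {n : ℕ} (D D' : Fin n → X) : Prop :=
  ∃ i, D i ≠ D' i ∧ ∀ j, j ≠ i → D j = D' j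

/-- A randomized algorithm `M` mapping datasets to measures on an output space is
`(ε,δ)`-differentially private if for all neighboring datasets `D, D'` and all measurable
output sets `S`, `P[M(D) ∈ S] ≤ e^ε P[M(D') ∈ S] + δ`. -/
def IsDP {X : Type*} {n : ℕ} {O : Type*} [MeasurableSpace O]
    (M : (Fin n → X) → Measure O) (ε δ : ℝ) : Prop :=
  ∀ D D' : Fin n → X, Neighboring D D' → ∀ S : Set O, MeasurableSet S →
    M D S ≤ ENNReal.ofReal (Real.exp ε) * M D' S + ENNReal.ofReal δ

/-- The Laplace distribution on `ℝ` with scale parameter `b`, given by the density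
`(1/(2b))e^{−|x|/b}` with respect to Lebesgue measure. -/
noncomputable def laplaceMeasure (b : ℝ) : Measure ℝ :=
  (volume : Measure ℝ).withDensity fun x => ENNReal.ofReal ((1 / (2 * b)) * Real.exp (-|x| / b))

theorem gaussianReal_eq_withDensity (w : ℝ) {v : NNReal} (hv : v ≠ 0) :
    gaussianReal w v = (gaussianReal 0 v).withDensity
      (fun x ↦ ENNReal.ofReal (Real.exp ((2 * w * x - w ^ 2) / (2 * v)))) := by
  rw [gaussianReal_of_var_ne_zero _ hv, gaussianReal_of_var_ne_zero _ hv,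
    ← withDensity_mul _ (by fun_prop) (by fun_prop)]
  congr 1
  ext x
  simp only [gaussianPDF, gaussianPDFReal, Pi.mul_apply]
  rw [← ENNReal.ofReal_mul (by positivity), mul_assoc _ (Real.exp _), ← Real.exp_add]
  congr 3
  field_simp
  ring

theorem lintegral_pi_prod {ι : Type*} [Fintype ι] (μ : ι → Measure ℝ)
    [∀ i, IsProbabilityMeasure (μ i)] (f : ι → ℝ → ENNReal) (hf : ∀ i, Measurable (f i)) :
    ∫⁻ x, ∏ i, f i (x i) ∂Measure.pi μ = ∏ i, ∫⁻ y, f i y ∂μ i := by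
  refine (lintegral_prod_eq_prod_lintegral_of_indepFun Finset.univ (fun i (x : ι → ℝ) ↦ f i (x i))
    (iIndepFun_pi fun i ↦ (hf i).aemeasurable)
    (fun i ↦ (hf i).comp (measurable_pi_apply i))).trans ?_
  exact Finset.prod_congr rfl fun i _ ↦
    (measurePreserving_eval μ i).lintegral_comp (hf i)

theorem pi_gaussianReal_eq_withDensity {ι : Type*} [Fintype ι] (w : ι → ℝ) {v : NNReal}
    (hv : v ≠ 0) :
    Measure.pi (fun i ↦ gaussianReal (w i) v) =
      (Measure.pi fun _ : ι ↦ gaussianReal 0 v).withDensity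
        (fun x ↦ ENNReal.ofReal (Real.exp (∑ i, (2 * w i * x i - w i ^ 2) / (2 * v)))) := by
  refine Measure.pi_eq fun s hs ↦ ?_
  rw [withDensity_apply _ (MeasurableSet.univ_pi hs),
    ← lintegral_indicator (MeasurableSet.univ_pi hs)]
  calc
    _ = ∫⁻ x, ∏ i, (s i).indicator
          (fun y ↦ ENNReal.ofReal (Real.exp ((2 * w i * y - w i ^ 2) / (2 * v)))) (x i)
          ∂Measure.pi fun _ : ι ↦ gaussianReal 0 v := by
      refine lintegral_congr fun x ↦ ?_
      by_cases hx : x ∈ Set.univ.pi s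
      · rw [Set.indicator_of_mem hx, Real.exp_sum,
          ENNReal.ofReal_prod_of_nonneg fun _ _ ↦ by positivity]
        exact Finset.prod_congr rfl fun i hi ↦ by
          rw [Set.indicator_of_mem (hx i (Set.mem_univ i))]
      · rw [Set.indicator_of_notMem hx]
        obtain ⟨i, hi⟩ : ∃ i, x i ∉ s i := by simpa using hx
        exact (Finset.prod_eq_zero (Finset.mem_univ i) (Set.indicator_of_notMem hi _)).symm
    _ = _ := by
      rw [lintegral_pi_prod _ _ fun i ↦ by
        refine Measurable.indicator ?_ (hs i)
        fun_prop]
      refine Finset.prod_congr rfl fun i _ ↦ ?_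
      rw [lintegral_indicator (hs i), gaussianReal_eq_withDensity (w i) hv,
        withDensity_apply _ (hs i)]

theorem map_const_add_pi_gaussianReal {ι : Type*} [Fintype ι] (w : ι → ℝ) (v : NNReal) :
    (Measure.pi fun _ : ι ↦ gaussianReal 0 v).map (fun x ↦ w + x) =
      Measure.pi (fun i ↦ gaussianReal (w i) v) := by
  rw [show (fun x : ι → ℝ ↦ w + x) = fun x i ↦ w i + x i from rfl,
    Measure.pi_map_pi fun i ↦ by fun_prop]
  simp [gaussianReal_map_const_add]

theorem map_sum_mul_pi_gaussianReal {ι : Type*} [Fintype ι] (w : ι → ℝ) (v : NNReal) :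
    (Measure.pi fun _ : ι ↦ gaussianReal 0 v).map (fun x ↦ ∑ i, w i * x i) =
      gaussianReal 0 ((∑ i, w i ^ 2).toNNReal * v) := by
  refine Measure.ext_of_charFun (funext fun t ↦ ?_)
  have hmap : (Measure.pi fun _ : ι ↦ gaussianReal 0 v).map (fun x ↦ ∑ i, w i * x i) =
      (Measure.pi fun i ↦ (gaussianReal 0 v).map (w i * ·)).map (fun x ↦ ∑ i, x i) := by
    rw [← Measure.pi_map_pi fun i ↦ by fun_prop, Measure.map_map (by fun_prop) (by fun_prop)]
    rfl
  simp_rw [hmap, gaussianReal_map_const_mul]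
  rw [charFun_map_sum_pi_eq_prod]
  simp only [Finset.prod_apply, charFun_gaussianReal]
  rw [← Complex.exp_sum]
  congr 1
  simp
  rw [max_eq_left (by positivity)]
  push_cast
  simp_rw [Finset.sum_mul, Finset.sum_div]

theorem gaussianReal_Ioi_zero_le {v : NNReal} :
    gaussianReal 0 v (Set.Ioi 0) ≤ ENNReal.ofReal (1 / 2) := by
  have h : gaussianReal 0 v (Set.Ioi 0) = gaussianReal 0 v (Set.Iio 0) := by
    conv_lhs => rw [← neg_zero (G := ℝ), ← gaussianReal_map_neg,
      Measure.map_apply measurable_neg measurableSet_Ioi]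
    simp
  have h2 : gaussianReal 0 v (Set.Ioi 0) + gaussianReal 0 v (Set.Iio 0) ≤ 1 := by
    rw [← measure_union (by grind) measurableSet_Iio]
    exact prob_le_one
  rw [← h, ← two_mul] at h2
  rw [one_div, ENNReal.ofReal_inv_of_pos two_pos, ENNReal.le_inv_iff_mul_le, mul_comm]
  simpa using h2

theorem gaussianReal_Ioi_le_of_nonneg {t : ℝ} (ht : 0 ≤ t) :
    gaussianReal 0 1 (Set.Ioi t) ≤ ENNReal.ofReal (1 / 2 * Real.exp (-t ^ 2 / 2)) := by
  have h : gaussianReal 0 1 (Set.Ioi t) = gaussianReal (-t) 1 (Set.Ioi 0) := by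
    rw [← zero_add (-t), ← gaussianReal_map_add_const,
      Measure.map_apply (by fun_prop) measurableSet_Ioi]
    congr 1
    ext x
    simp
  rw [h, gaussianReal_eq_withDensity (-t) one_ne_zero, withDensity_apply _ measurableSet_Ioi]
  calc
    _ ≤ ∫⁻ _ in Set.Ioi 0, ENNReal.ofReal (Real.exp (-t ^ 2 / 2)) ∂gaussianReal 0 1 := by
      refine setLIntegral_mono (by fun_prop) fun x hx ↦ ?_
      have : 0 ≤ t * x := mul_nonneg ht (le_of_lt hx)
      refine ENNReal.ofReal_le_ofReal (Real.exp_le_exp.2 ?_)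
      push_cast
      linarith
    _ ≤ _ := by
      rw [setLIntegral_const, mul_comm, ENNReal.ofReal_mul (by norm_num)]
      gcongr
      exact gaussianReal_Ioi_zero_le

theorem gaussianReal_Ioi_le_of_nonpos {t : ℝ} (ht : t ≤ 0) :
    gaussianReal 0 1 (Set.Ioi t) ≤ ENNReal.ofReal (1 / 2 - t) := by
  have hpdf (x : ℝ) : gaussianPDF 0 1 x ≤ 1 := by
    rw [gaussianPDF, ENNReal.ofReal_le_one, gaussianPDFReal]
    refine mul_le_one₀ (inv_le_one_of_one_le₀ ?_) (by positivity) ?_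
    · rw [Real.one_le_sqrt]
      push_cast
      linarith [Real.pi_gt_three]
    · rw [Real.exp_le_one_iff]
      push_cast
      nlinarith [sq_nonneg (x - 0)]
  calc
    gaussianReal 0 1 (Set.Ioi t) ≤
        gaussianReal 0 1 (Set.Ioi 0) + gaussianReal 0 1 (Set.Ioc t 0) := by
      rw [← Set.Ioc_union_Ioi_eq_Ioi ht, Set.union_comm]
      exact measure_union_le _ _
    _ ≤ ENNReal.ofReal (1 / 2) + ENNReal.ofReal (-t) := by
      gcongr
      · exact gaussianReal_Ioi_zero_le
      · rw [gaussianReal_apply _ one_ne_zero]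
        calc
          _ ≤ ∫⁻ _ in Set.Ioc t 0, 1 := lintegral_mono hpdf
          _ = _ := by simp
    _ = _ := by
      rw [← ENNReal.ofReal_add (by norm_num) (by linarith)]
      ring_nf

/-- The tail bound behind the constant `1.25`: if `δ = 1.25 * exp (-c ^ 2 / 2)`, then a standard
Gaussian exceeds `c - 1 / (2 * c)` with probability at most `δ`. -/
theorem gaussianReal_Ioi_le {c δ t : ℝ} (hc : 0 < c) (hδ0 : 0 < δ) (hδ : δ < 1)
    (hcδ : c ^ 2 = 2 * Real.log (1.25 / δ)) (ht : c - 1 / (2 * c) ≤ t) :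
    gaussianReal 0 1 (Set.Ioi t) ≤ ENNReal.ofReal δ := by
  have hδ_eq : δ = 1.25 * Real.exp (-c ^ 2 / 2) := by
    rw [hcδ, neg_div, mul_div_cancel_left₀ _ two_ne_zero, Real.exp_neg,
      Real.exp_log (by positivity)]
    field_simp
  refine (measure_mono (Set.Ioi_subset_Ioi ht)).trans ?_
  have hsq : (c - 1 / (2 * c)) ^ 2 = c ^ 2 - 1 + (1 / (2 * c)) ^ 2 := by
    field_simp
    ring
  rcases le_total 0 (c - 1 / (2 * c)) with h | h
  · refine (gaussianReal_Ioi_le_of_nonneg h).trans (ENNReal.ofReal_le_ofReal ?_)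
    have hexp : Real.exp (-(c - 1 / (2 * c)) ^ 2 / 2) ≤
        Real.exp (1 / 2) * Real.exp (-c ^ 2 / 2) := by
      rw [← Real.exp_add]
      gcongr
      nlinarith [sq_nonneg (1 / (2 * c))]
    have hhalf : Real.exp (1 / 2) ≤ 2 := by
      have := Real.exp_bound_div_one_sub_of_interval (x := 1 / 2) (by norm_num) (by norm_num)
      norm_num at this ⊢
      exact this
    rw [hδ_eq]
    nlinarith [Real.exp_pos (-c ^ 2 / 2)]
  · refine (gaussianReal_Ioi_le_of_nonpos h).trans (ENNReal.ofReal_le_ofReal ?_)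
    have hc2 : c ^ 2 ≤ 1 / 2 := by
      have : c ≤ 1 / (2 * c) := by linarith
      rw [le_div_iff₀ (by positivity)] at this
      nlinarith
    have hδ_ge : 15 / 16 ≤ δ := by
      have := Real.add_one_le_exp (-c ^ 2 / 2)
      rw [hδ_eq]
      linarith
    have hlog : 1 - (1.25 / δ)⁻¹ ≤ Real.log (1.25 / δ) :=
      Real.one_sub_inv_le_log_of_pos (by positivity)
    have hinv : (1.25 / δ)⁻¹ ≤ 0.8 := by
      rw [inv_div, div_le_iff₀ (by norm_num)]
      linarith
    have hc3 : 0.6 ≤ c := by nlinarith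
    have hdiv : 1 / (2 * c) ≤ 1 := by
      rw [div_le_one (by positivity)]
      linarith
    linarith

theorem pi_gaussianReal_sum_mul_lt {ι : Type*} [Fintype ι] (w : ι → ℝ) (v : NNReal) (b : ℝ)
    {r : ℝ} (hr : 0 < r) (hrv : r ^ 2 = (∑ i, w i ^ 2) * v) :
    (Measure.pi fun _ : ι ↦ gaussianReal 0 v) {x | ∑ i, w i * x i < b} =
      gaussianReal 0 1 (Set.Ioi (-b / r)) := by
  have hstd : gaussianReal 0 ((∑ i, w i ^ 2).toNNReal * v) =
      (gaussianReal 0 1).map ((-r) * ·) := by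
    rw [gaussianReal_map_const_mul]
    congr 1
    · simp
    · ext
      simp [hrv, Real.coe_toNNReal _ (show 0 ≤ ∑ i, w i ^ 2 by positivity)]
  rw [show {x : ι → ℝ | ∑ i, w i * x i < b} = (fun x ↦ ∑ i, w i * x i) ⁻¹' Set.Iio b from rfl,
    ← Measure.map_apply (by fun_prop) measurableSet_Iio, map_sum_mul_pi_gaussianReal, hstd,
    Measure.map_apply (by fun_prop) measurableSet_Iio]
  congr 1
  ext x
  simp only [Set.mem_preimage, Set.mem_Iio, Set.mem_Ioi]
  rw [div_lt_iff₀ hr]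
  constructor <;> intro h <;> linarith

/-- Adding i.i.d. centered Gaussian noise of variance `v` to two vectors differing by `w` gives
distributions that are `(ε, η)`-close, where `η` is the probability that the log-likelihood ratio
falls below `-ε`. -/
theorem pi_gaussianReal_le_exp_mul_map_add {ι : Type*} [Fintype ι] (w : ι → ℝ) {v : NNReal}
    (hv : v ≠ 0) (ε : ℝ) {B : Set (ι → ℝ)} (hB : MeasurableSet B) :
    (Measure.pi fun _ : ι ↦ gaussianReal 0 v) B ≤
      ENNReal.ofReal (Real.exp ε) *
          (Measure.pi fun _ : ι ↦ gaussianReal 0 v).map (fun x ↦ w + x) B +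
        (Measure.pi fun _ : ι ↦ gaussianReal 0 v)
          {x | ∑ i, w i * x i < (∑ i, w i ^ 2) / 2 - ε * v} := by
  set μ := Measure.pi fun _ : ι ↦ gaussianReal 0 v
  set E : Set (ι → ℝ) := {x | ∑ i, w i * x i < (∑ i, w i ^ 2) / 2 - ε * v}
  have hE : MeasurableSet E := measurableSet_lt (by fun_prop) (by fun_prop)
  have hv' : (0 : ℝ) < v := by positivity
  calc
    μ B ≤ μ (B \ E) + μ E := by
      refine (measure_mono fun x hx ↦ ?_).trans (measure_union_le _ _)
      by_cases hxE : x ∈ E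
      · exact Or.inr hxE
      · exact Or.inl ⟨hx, hxE⟩
    _ ≤ _ := by
      gcongr
      rw [map_const_add_pi_gaussianReal, pi_gaussianReal_eq_withDensity w hv,
        withDensity_apply _ hB, ← lintegral_const_mul _ (by fun_prop), ← setLIntegral_one]
      refine (setLIntegral_mono (by fun_prop) fun x hx ↦ ?_).trans
        (lintegral_mono_set Set.sdiff_subset)
      have hxE : (∑ i, w i ^ 2) / 2 - ε * v ≤ ∑ i, w i * x i := not_lt.1 hx.2
      rw [← ENNReal.ofReal_mul (by positivity), ← Real.exp_add, ENNReal.one_le_ofReal,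
        Real.one_le_exp_iff, ← Finset.sum_div, Finset.sum_sub_distrib]
      simp_rw [mul_assoc]
      rw [← Finset.mul_sum, ← neg_le_iff_add_nonneg', le_div_iff₀ (by positivity)]
      linarith

/-- Gaussian mechanism: adding i.i.d. centered Gaussian noise with standard deviation
`√(2 log(1.25/δ))·Δ₂(T)/ε` to each coordinate of a map `T` into `ℝ^m` with ℓ₂-sensitivity
`Δ₂(T)` yields an `(ε,δ)`-differentially private algorithm, for `0 < ε, δ < 1`. -/
theorem gaussian_mechanism {X : Type*} {n m : ℕ}
    (T : (Fin n → X) → (Fin m → ℝ)) (Δ ε δ : ℝ) (hΔ : 0 < Δ)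
    (hε : 0 < ε) (hε1 : ε < 1) (hδ : 0 < δ) (hδ1 : δ < 1)
    (hsens : ∀ D D', Neighboring D D' → Real.sqrt (∑ j, (T D j - T D' j) ^ 2) ≤ Δ) :
    IsDP (fun D => Measure.map (fun ξ => T D + ξ)
        (Measure.pi fun _ : Fin m =>
          gaussianReal 0 (Real.toNNReal ((Real.sqrt (2 * Real.log (1.25 / δ)) * Δ / ε) ^ 2)))) ε δ := by
  intro D D' hDD' S hS
  set c := Real.sqrt (2 * Real.log (1.25 / δ))
  have hlog : 0 < Real.log (1.25 / δ) := Real.log_pos (by rw [lt_div_iff₀ hδ]; linarith)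
  have hc : 0 < c := Real.sqrt_pos.2 (by positivity)
  have hcδ : c ^ 2 = 2 * Real.log (1.25 / δ) := Real.sq_sqrt (by positivity)
  set σ := c * Δ / ε with hσ_def
  have hσ : 0 < σ := by positivity
  set v := Real.toNNReal (σ ^ 2)
  have hv_coe : (v : ℝ) = σ ^ 2 := Real.coe_toNNReal _ (by positivity)
  have hv : v ≠ 0 := (Real.toNNReal_pos.2 (by positivity)).ne'
  let w : Fin m → ℝ := T D' - T D
  set L := Real.sqrt (∑ j, w j ^ 2) with hL_def
  have hL_sq : L ^ 2 = ∑ j, w j ^ 2 := Real.sq_sqrt (by positivity)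
  have hLΔ : L ≤ Δ := by
    refine le_trans (le_of_eq ?_) (hsens D D' hDD')
    simp_rw [hL_def, w, Pi.sub_apply, sub_sq_comm (T D' _)]
  have hB : MeasurableSet ((fun ξ ↦ T D + ξ) ⁻¹' S) := hS.preimage (by fun_prop)
  have hshift : (fun ξ ↦ T D' + ξ) = (fun ξ ↦ T D + ξ) ∘ (fun ξ ↦ w + ξ) := by
    ext ξ j
    simp only [w, Function.comp_apply, Pi.add_apply, Pi.sub_apply]
    ring
  dsimp only
  rw [hshift, ← Measure.map_map (by fun_prop) (by fun_prop),
    Measure.map_apply (by fun_prop) hS, Measure.map_apply (by fun_prop) hS]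
  refine (pi_gaussianReal_le_exp_mul_map_add w hv ε hB).trans ?_
  gcongr
  have hL0 : 0 ≤ L := Real.sqrt_nonneg _
  rcases hL0.eq_or_lt with hL | hL
  · have hw : ∀ j, w j = 0 := by
      rw [← hL, zero_pow two_ne_zero, eq_comm,
        Finset.sum_eq_zero_iff_of_nonneg fun j _ ↦ sq_nonneg (w j)] at hL_sq
      exact fun j ↦ by simpa using hL_sq j (Finset.mem_univ j)
    have : ¬ ε * (v : ℝ) < 0 := not_lt.2 (by positivity)
    simp [hw, this]
  · rw [pi_gaussianReal_sum_mul_lt w v _ (mul_pos hL hσ) (by rw [mul_pow, hL_sq, hv_coe])]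
    refine gaussianReal_Ioi_le hc hδ hδ1 hcδ ?_
    rw [le_div_iff₀ (by positivity), ← hL_sq, hv_coe]
    have hεσ : ε * σ = c * Δ := by
      rw [hσ_def]
      field_simp
    have hcL : c * L ≤ σ := by nlinarith
    have hsub : (c - 1 / (2 * c)) * (L * σ) = c * L * σ - L * σ / (2 * c) := by
      field_simp
    have hhalf : L ^ 2 / 2 ≤ L * σ / (2 * c) := by
      rw [le_div_iff₀ (by positivity)]
      nlinarith
    have hmain : c * L * σ ≤ ε * σ ^ 2 := by
      rw [sq, ← mul_assoc, hεσ]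
      gcongr
    rw [hsub]
    linarith
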